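/- Let d ∈ ℕ, c ∈ [1,∞), and let p¹,…,p^d be probability kernels on [0,1] such that for every k ∈ {1,…,d}, every m' ∈ {0,1,2,3}, and every φ ∈ C^{m'}([0,1],ℝ) the function z ↦ ∫ φ(y) p^k(z,dy) belongs to C^{m'}([0,1],ℝ) and satisfies ‖z ↦ ∫ φ(y) p^k(z,dy)‖_{C^{m'}} ≤ c ‖φ‖_{C^{m'}}. Then for every f ∈ C³([0,1]^d,ℝ) and every i, j, l ∈ {1,…,d} the mixed third partial derivative [0,1]^d ∋ x ↦ (∂³/∂x_i∂x_j∂x_l) ∫ f(y) ⊗_{k=1}^d p^k(x_k,dy_k), where the integral is with respect to the product measure ⊗_{k=1}^d p^k(x_k,·), exists and is continuous on [0,1]^d. -/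

import Mathlib

open MeasureTheory Filter

noncomputable section

/-- The unit cube `[0,1]^d` in `ℝ^d`. -/
def cube (d : ℕ) : Set (Fin d → ℝ) := Set.univ.pi fun _ => Set.Icc (0:ℝ) 1

/-- Partial derivative in coordinate `i` (within `[0,1]`, i.e. one-sided at the boundary). -/
def pd (d : ℕ) (i : Fin d) (g : (Fin d → ℝ) → ℝ) : (Fin d → ℝ) → ℝ :=
  fun x => derivWithin (fun t => g (Function.update x i t)) (Set.Icc (0:ℝ) 1) (x i)

/-- Iterated partial derivative `∂^α` (coordinates applied in a fixed order). -/
def mderiv (d : ℕ) (α : Fin d → ℕ) (f : (Fin d → ℝ) → ℝ) : (Fin d → ℝ) → ℝ :=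
  List.foldr (fun i g => (pd d i)^[α i] g) f (List.finRange d)

/-- `f ∈ C^m([0,1]^d, ℝ)`: all partial derivatives of order `0` through `m` exist
(one-sidedly at the boundary) and are continuous on the cube. -/
def MemCm (d : ℕ) : ℕ → ((Fin d → ℝ) → ℝ) → Prop
  | 0, f => ContinuousOn f (cube d)
  | m + 1, f => ContinuousOn f (cube d) ∧ ∀ i : Fin d,
      (∀ x ∈ cube d, DifferentiableWithinAt ℝ (fun t => f (Function.update x i t))
        (Set.Icc (0:ℝ) 1) (x i)) ∧
      MemCm d m (pd d i f)

/-- Sup norm over the cube: `‖g‖_∞ = sup_{x ∈ [0,1]^d} |g(x)|`. -/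
def supCube (d : ℕ) (g : (Fin d → ℝ) → ℝ) : ℝ := ⨆ x : cube d, |g x.1|

/-- The `C^m`-norm: `max_{|α| ≤ m} sup_{x ∈ [0,1]^d} |∂^α f(x)|`. -/
def CmNorm (d m : ℕ) (f : (Fin d → ℝ) → ℝ) : ℝ :=
  ⨆ α : {α : Fin d → ℕ // (∑ i, α i) ≤ m}, supCube d (mderiv d α.1 f)

/-- `λ_m := max_{0 < |α| ≤ m} ∑_i ‖∂^α b_i‖_∞`. -/
def lamNorm (d m : ℕ) (b : Fin d → (Fin d → ℝ) → ℝ) : ℝ :=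
  ⨆ α : {α : Fin d → ℕ // 0 < (∑ i, α i) ∧ (∑ i, α i) ≤ m},
    ∑ i, supCube d (mderiv d α.1 (b i))

/-- One-sided derivative within `[0,1]` for a one-dimensional function. -/
noncomputable def dI (φ : ℝ → ℝ) : ℝ → ℝ := fun z => derivWithin φ (Set.Icc (0:ℝ) 1) z

/-- `φ ∈ C^m([0,1], ℝ)`: derivatives of order `0` through `m` exist
(one-sidedly at the boundary) and are continuous on `[0,1]`. -/
def MemC1d : ℕ → (ℝ → ℝ) → Prop
  | 0, φ => ContinuousOn φ (Set.Icc (0:ℝ) 1)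
  | m + 1, φ => ContinuousOn φ (Set.Icc (0:ℝ) 1) ∧
      (∀ z ∈ Set.Icc (0:ℝ) 1, DifferentiableWithinAt ℝ φ (Set.Icc (0:ℝ) 1) z) ∧
      MemC1d m (dI φ)

/-- The `C^m`-norm of a one-dimensional function: `max_{k ≤ m} sup_{z ∈ [0,1]} |φ^{(k)}(z)|`. -/
noncomputable def C1dNorm (m : ℕ) (φ : ℝ → ℝ) : ℝ :=
  ⨆ k : Fin (m + 1), ⨆ z : Set.Icc (0:ℝ) 1, |dI^[(k : ℕ)] φ z.1|

/-- `PEC d [i₁, …, i_n] g` means: the successive partial derivatives of `g` in the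
coordinates `i₁, …, i_n` (in this order, one-sided at the boundary) exist at every point
of the cube, and the final `n`-th order partial derivative is continuous on the cube. -/
def PEC (d : ℕ) : List (Fin d) → ((Fin d → ℝ) → ℝ) → Prop
  | [], g => ContinuousOn g (cube d)
  | i :: L, g => (∀ x ∈ cube d, DifferentiableWithinAt ℝ
      (fun t => g (Function.update x i t)) (Set.Icc (0:ℝ) 1) (x i)) ∧
      PEC d L (pd d i g)

lemma MemC1d.continuousOn {m : ℕ} {φ : ℝ → ℝ} (h : MemC1d m φ) :
    ContinuousOn φ (Set.Icc (0:ℝ) 1) := by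
  cases m with
  | zero => exact h
  | succ m => exact h.1

lemma MemCm.continuousOn {d m : ℕ} {f : (Fin d → ℝ) → ℝ} (h : MemCm d m f) :
    ContinuousOn f (cube d) := by
  cases m with
  | zero => exact h
  | succ m => exact h.1

lemma MemCm.of_succ {d m : ℕ} {f : (Fin d → ℝ) → ℝ} (h : MemCm d (m + 1) f) :
    MemCm d m f := by
  induction m generalizing f with
  | zero => exact h.1
  | succ m ih => exact ⟨h.1, fun i => ⟨(h.2 i).1, ih (h.2 i).2⟩⟩

lemma MemCm.mono {d m n : ℕ} {f : (Fin d → ℝ) → ℝ} (h : MemCm d n f) (hmn : m ≤ n) :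
    MemCm d m f := by
  induction hmn with
  | refl => exact h
  | step _ ih => exact ih h.of_succ

lemma update_mem_cube {d : ℕ} {x : Fin d → ℝ} (hx : x ∈ cube d) (i : Fin d) {t : ℝ}
    (ht : t ∈ Set.Icc (0:ℝ) 1) : Function.update x i t ∈ cube d := by
  intro j _
  rcases eq_or_ne j i with rfl | h
  · simpa using ht
  · simpa [h] using hx j trivial

lemma pd_eqOn_cube {d : ℕ} {f g : (Fin d → ℝ) → ℝ} (h : Set.EqOn f g (cube d)) (i : Fin d) :
    Set.EqOn (pd d i f) (pd d i g) (cube d) := by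
  intro x hx
  refine derivWithin_congr (fun t ht => h (update_mem_cube hx i ht)) ?_
  exact h (update_mem_cube hx i (hx i trivial))

lemma pd_iterate_eqOn_cube {d : ℕ} {f g : (Fin d → ℝ) → ℝ} (h : Set.EqOn f g (cube d))
    (i : Fin d) (n : ℕ) : Set.EqOn ((pd d i)^[n] f) ((pd d i)^[n] g) (cube d) := by
  induction n with
  | zero => exact h
  | succ n ih => simpa only [Function.iterate_succ_apply'] using pd_eqOn_cube ih i

lemma MemCm.congr {d m : ℕ} {f g : (Fin d → ℝ) → ℝ} (hf : MemCm d m f)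
    (h : Set.EqOn f g (cube d)) : MemCm d m g := by
  induction m generalizing f g with
  | zero => exact ContinuousOn.congr hf h.symm
  | succ m ih =>
    refine ⟨hf.1.congr h.symm, fun i => ⟨fun x hx => ?_, ih (hf.2 i).2 (pd_eqOn_cube h i)⟩⟩
    exact ((hf.2 i).1 x hx).congr (fun t ht => (h (update_mem_cube hx i ht)).symm)
      (h (update_mem_cube hx i (hx i trivial))).symm

lemma MemCm.pd_iterate {d m n : ℕ} {f : (Fin d → ℝ) → ℝ} (i : Fin d)
    (hf : MemCm d (n + m) f) : MemCm d m ((pd d i)^[n] f) := by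
  induction n generalizing f with
  | zero => simpa using hf
  | succ n ih =>
    rw [Nat.add_right_comm] at hf
    exact ih (hf.2 i).2

lemma dI_update {d : ℕ} (f : (Fin d → ℝ) → ℝ) (x : Fin d → ℝ) (k : Fin d) :
    dI (fun s => f (Function.update x k s)) = fun s => pd d k f (Function.update x k s) := by
  funext s
  simp [dI, pd]

lemma dI_iterate_update {d : ℕ} (f : (Fin d → ℝ) → ℝ) (x : Fin d → ℝ) (k : Fin d) (n : ℕ) :
    dI^[n] (fun s => f (Function.update x k s)) =
      fun s => (pd d k)^[n] f (Function.update x k s) := by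
  induction n generalizing f with
  | zero => rfl
  | succ n ih => rw [Function.iterate_succ_apply, dI_update, ih, Function.iterate_succ_apply]

lemma continuousOn_update {d : ℕ} {f : (Fin d → ℝ) → ℝ} (hf : ContinuousOn f (cube d))
    {x : Fin d → ℝ} (hx : x ∈ cube d) (k : Fin d) :
    ContinuousOn (fun s => f (Function.update x k s)) (Set.Icc (0:ℝ) 1) :=
  hf.comp ((continuous_const (y := x)).update k continuous_id).continuousOn
    fun _ hs => update_mem_cube hx k hs

lemma MemCm.memC1d_update {d m : ℕ} {f : (Fin d → ℝ) → ℝ} (hf : MemCm d m f)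
    {x : Fin d → ℝ} (hx : x ∈ cube d) (k : Fin d) :
    MemC1d m (fun s => f (Function.update x k s)) := by
  induction m generalizing f with
  | zero => exact continuousOn_update hf hx k
  | succ m ih =>
    refine ⟨continuousOn_update hf.1 hx k, fun z hz => ?_, ?_⟩
    · simpa using (hf.2 k).1 _ (update_mem_cube hx k hz)
    · rw [dI_update]
      exact ih (hf.2 k).2

lemma MemC1d.congr {m : ℕ} {φ ψ : ℝ → ℝ} (hφ : MemC1d m φ)
    (h : Set.EqOn φ ψ (Set.Icc (0:ℝ) 1)) : MemC1d m ψ := by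
  induction m generalizing φ ψ with
  | zero => exact ContinuousOn.congr hφ h.symm
  | succ m ih =>
    exact ⟨hφ.1.congr h.symm, fun z hz => (hφ.2.1 z hz).congr h.symm (h hz).symm,
      ih hφ.2.2 fun z hz => derivWithin_congr h (h hz)⟩

lemma dI_iterate_eqOn {φ ψ : ℝ → ℝ} (h : Set.EqOn φ ψ (Set.Icc (0:ℝ) 1)) (n : ℕ) :
    Set.EqOn (dI^[n] φ) (dI^[n] ψ) (Set.Icc (0:ℝ) 1) := by
  induction n generalizing φ ψ with
  | zero => exact h
  | succ n ih => exact ih fun z hz => derivWithin_congr h (h hz)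

lemma MemC1d.dI_iterate {m n : ℕ} {φ : ℝ → ℝ} (hφ : MemC1d (n + m) φ) :
    MemC1d m (dI^[n] φ) := by
  induction n generalizing φ with
  | zero => simpa using hφ
  | succ n ih =>
    rw [Nat.add_right_comm] at hφ
    exact ih hφ.2.2

lemma dI_add_const_mul_eqOn {m : ℕ} {φ ψ : ℝ → ℝ} (hφ : MemC1d (m + 1) φ)
    (hψ : MemC1d (m + 1) ψ) (r : ℝ) :
    Set.EqOn (dI fun z => φ z + r * ψ z) (fun z => dI φ z + r * dI ψ z) (Set.Icc (0:ℝ) 1) := by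
  intro z hz
  exact ((hφ.2.1 z hz).hasDerivWithinAt.add
    ((hψ.2.1 z hz).hasDerivWithinAt.const_mul r)).derivWithin
      (uniqueDiffOn_Icc one_pos z hz)

lemma MemC1d.add_const_mul {m : ℕ} {φ ψ : ℝ → ℝ} (hφ : MemC1d m φ) (hψ : MemC1d m ψ) (r : ℝ) :
    MemC1d m (fun z => φ z + r * ψ z) := by
  induction m generalizing φ ψ with
  | zero => exact ContinuousOn.add hφ (continuousOn_const.mul hψ)
  | succ m ih =>
    refine ⟨hφ.1.add (continuousOn_const.mul hψ.1), fun z hz => ?_, ?_⟩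
    · exact (hφ.2.1 z hz).add ((hψ.2.1 z hz).const_mul r)
    · exact (ih hφ.2.2 hψ.2.2).congr (dI_add_const_mul_eqOn hφ hψ r).symm

lemma dI_iterate_add_const_mul_eqOn {m : ℕ} {φ ψ : ℝ → ℝ} (hφ : MemC1d m φ)
    (hψ : MemC1d m ψ) (r : ℝ) :
    Set.EqOn (dI^[m] fun z => φ z + r * ψ z) (fun z => dI^[m] φ z + r * dI^[m] ψ z)
      (Set.Icc (0:ℝ) 1) := by
  induction m generalizing φ ψ with
  | zero => exact fun _ _ => rfl
  | succ m ih =>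
    exact (dI_iterate_eqOn (dI_add_const_mul_eqOn hφ hψ r) m).trans (ih hφ.2.2 hψ.2.2)

lemma exists_mixed_difference_eq {u v w : ℝ → ℝ → ℝ}
    (hu : ∀ s ∈ Set.Icc (0:ℝ) 1, ∀ t ∈ Set.Icc (0:ℝ) 1,
      HasDerivWithinAt (fun r => u r t) (v s t) (Set.Icc (0:ℝ) 1) s)
    (hv : ∀ s ∈ Set.Icc (0:ℝ) 1, ∀ t ∈ Set.Icc (0:ℝ) 1,
      HasDerivWithinAt (fun r => v s r) (w s t) (Set.Icc (0:ℝ) 1) t)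
    {s₀ s₁ t₀ t₁ : ℝ} (hs₀ : 0 ≤ s₀) (hs : s₀ < s₁) (hs₁ : s₁ ≤ 1)
    (ht₀ : 0 ≤ t₀) (ht : t₀ < t₁) (ht₁ : t₁ ≤ 1) :
    ∃ ξ ∈ Set.Ioo s₀ s₁, ∃ η ∈ Set.Ioo t₀ t₁,
      u s₁ t₁ - u s₁ t₀ - u s₀ t₁ + u s₀ t₀ = w ξ η * ((s₁ - s₀) * (t₁ - t₀)) := by
  have hIs : Set.Icc s₀ s₁ ⊆ Set.Icc (0:ℝ) 1 := Set.Icc_subset_Icc hs₀ hs₁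
  have hIt : Set.Icc t₀ t₁ ⊆ Set.Icc (0:ℝ) 1 := Set.Icc_subset_Icc ht₀ ht₁
  have h0 : t₀ ∈ Set.Icc (0:ℝ) 1 := hIt (Set.left_mem_Icc.2 ht.le)
  have h1 : t₁ ∈ Set.Icc (0:ℝ) 1 := hIt (Set.right_mem_Icc.2 ht.le)
  have hd : ∀ s ∈ Set.Icc (0:ℝ) 1,
      HasDerivWithinAt (fun r => u r t₁ - u r t₀) (v s t₁ - v s t₀) (Set.Icc (0:ℝ) 1) s :=
    fun s hs => (hu s hs t₁ h1).sub (hu s hs t₀ h0)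
  obtain ⟨ξ, hξ, e₁⟩ := exists_hasDerivAt_eq_slope (fun r => u r t₁ - u r t₀)
    (fun s => v s t₁ - v s t₀) hs
    (fun s hs => ((hd s (hIs hs)).continuousWithinAt).mono hIs)
    (fun s hs => (hd s (hIs (Set.Ioo_subset_Icc_self hs))).hasDerivAt
      (Icc_mem_nhds (hs₀.trans_lt hs.1) (hs.2.trans_le hs₁)))
  have hξI := hIs (Set.Ioo_subset_Icc_self hξ)
  obtain ⟨η, hη, e₂⟩ := exists_hasDerivAt_eq_slope (fun r => v ξ r) (fun t => w ξ t) ht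
    (fun t ht => ((hv ξ hξI t (hIt ht)).continuousWithinAt).mono hIt)
    (fun t ht => (hv ξ hξI t (hIt (Set.Ioo_subset_Icc_self ht))).hasDerivAt
      (Icc_mem_nhds (ht₀.trans_lt ht.1) (ht.2.trans_le ht₁)))
  refine ⟨ξ, hξ, η, hη, ?_⟩
  have hs' : s₁ - s₀ ≠ 0 := (sub_pos.2 hs).ne'
  have ht' : t₁ - t₀ ≠ 0 := (sub_pos.2 ht).ne'
  rw [eq_div_iff hs'] at e₁
  rw [eq_div_iff ht'] at e₂
  linear_combination -e₁ - (s₁ - s₀) * e₂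

lemma exists_Icc_subset_near {s δ : ℝ} (hs : s ∈ Set.Icc (0:ℝ) 1) (hδ : 0 < δ) :
    ∃ s₀ s₁ : ℝ, 0 ≤ s₀ ∧ s₀ < s₁ ∧ s₁ ≤ 1 ∧ ∀ r ∈ Set.Ioo s₀ s₁, |r - s| < δ := by
  rcases hs.2.lt_or_eq with h | h
  · refine ⟨s, min 1 (s + δ), hs.1, lt_min h (by linarith), min_le_left _ _, fun r hr => ?_⟩
    have := hr.2.trans_le (min_le_right _ _)
    rw [abs_lt]
    constructor <;> linarith [hr.1]
  · refine ⟨max 0 (1 - δ), 1, le_max_left _ _, max_lt one_pos (by linarith), le_rfl,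
      fun r hr => ?_⟩
    have := (le_max_right _ _).trans_lt hr.1
    rw [abs_lt]
    constructor <;> linarith [hr.2]

lemma mixed_deriv_comm {u v v' w w' : ℝ → ℝ → ℝ}
    (hu : ∀ s ∈ Set.Icc (0:ℝ) 1, ∀ t ∈ Set.Icc (0:ℝ) 1,
      HasDerivWithinAt (fun r => u r t) (v s t) (Set.Icc (0:ℝ) 1) s)
    (hv : ∀ s ∈ Set.Icc (0:ℝ) 1, ∀ t ∈ Set.Icc (0:ℝ) 1,
      HasDerivWithinAt (fun r => v s r) (w s t) (Set.Icc (0:ℝ) 1) t)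
    (hu' : ∀ s ∈ Set.Icc (0:ℝ) 1, ∀ t ∈ Set.Icc (0:ℝ) 1,
      HasDerivWithinAt (fun r => u s r) (v' s t) (Set.Icc (0:ℝ) 1) t)
    (hv' : ∀ s ∈ Set.Icc (0:ℝ) 1, ∀ t ∈ Set.Icc (0:ℝ) 1,
      HasDerivWithinAt (fun r => v' r t) (w' s t) (Set.Icc (0:ℝ) 1) s)
    (hw : ContinuousOn (fun q : ℝ × ℝ => w q.1 q.2) (Set.Icc (0:ℝ) 1 ×ˢ Set.Icc (0:ℝ) 1))
    (hw' : ContinuousOn (fun q : ℝ × ℝ => w' q.1 q.2) (Set.Icc (0:ℝ) 1 ×ˢ Set.Icc (0:ℝ) 1))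
    {s t : ℝ} (hs : s ∈ Set.Icc (0:ℝ) 1) (ht : t ∈ Set.Icc (0:ℝ) 1) : w s t = w' s t := by
  refine eq_of_forall_dist_le fun ε hε => ?_
  obtain ⟨δ, hδ, h⟩ := Metric.continuousOn_iff.1 hw (s, t) ⟨hs, ht⟩ (ε / 2) (by positivity)
  obtain ⟨δ', hδ', h'⟩ := Metric.continuousOn_iff.1 hw' (s, t) ⟨hs, ht⟩ (ε / 2) (by positivity)
  obtain ⟨s₀, s₁, hs₀, hs01, hs₁, hsd⟩ := exists_Icc_subset_near hs (lt_min hδ hδ')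
  obtain ⟨t₀, t₁, ht₀, ht01, ht₁, htd⟩ := exists_Icc_subset_near ht (lt_min hδ hδ')
  obtain ⟨ξ, hξ, η, hη, e⟩ := exists_mixed_difference_eq hu hv hs₀ hs01 hs₁ ht₀ ht01 ht₁
  obtain ⟨η', hη', ξ', hξ', e'⟩ := exists_mixed_difference_eq (u := fun t s => u s t)
    (v := fun t s => v' s t) (w := fun t s => w' s t) (fun t ht s hs => hu' s hs t ht)
    (fun t ht s hs => hv' s hs t ht) ht₀ ht01 ht₁ hs₀ hs01 hs₁
  have hI : ∀ {a b r : ℝ}, 0 ≤ a → b ≤ 1 → r ∈ Set.Ioo a b → r ∈ Set.Icc (0:ℝ) 1 :=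
    fun ha hb hr => ⟨ha.trans hr.1.le, hr.2.le.trans hb⟩
  have key : w ξ η = w' ξ' η' := by
    have hne : (s₁ - s₀) * (t₁ - t₀) ≠ 0 :=
      (mul_pos (sub_pos.2 hs01) (sub_pos.2 ht01)).ne'
    refine mul_right_cancel₀ hne ?_
    linear_combination e' - e
  have d₁ := h (ξ, η) ⟨hI hs₀ hs₁ hξ, hI ht₀ ht₁ hη⟩
    (by rw [Prod.dist_eq]
        exact max_lt ((hsd ξ hξ).trans_le (min_le_left _ _))
          ((htd η hη).trans_le (min_le_left _ _)))
  have d₂ := h' (ξ', η') ⟨hI hs₀ hs₁ hξ', hI ht₀ ht₁ hη'⟩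
    (by rw [Prod.dist_eq]
        exact max_lt ((hsd ξ' hξ').trans_le (min_le_right _ _))
          ((htd η' hη').trans_le (min_le_right _ _)))
  simp only [key, Real.dist_eq, abs_lt] at d₁ d₂
  rw [Real.dist_eq, abs_le]
  constructor <;> linarith [d₁.1, d₁.2, d₂.1, d₂.2]

lemma MemCm.hasDerivWithinAt {d m : ℕ} {f : (Fin d → ℝ) → ℝ} (hf : MemCm d (m + 1) f)
    (i : Fin d) {x : Fin d → ℝ} (hx : x ∈ cube d) {s : ℝ} (hs : s ∈ Set.Icc (0:ℝ) 1) :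
    HasDerivWithinAt (fun r => f (Function.update x i r)) (pd d i f (Function.update x i s))
      (Set.Icc (0:ℝ) 1) s := by
  have := ((hf.2 i).1 _ (update_mem_cube hx i hs)).hasDerivWithinAt
  simpa [pd] using this

lemma pd_comm_eqOn {d : ℕ} {f : (Fin d → ℝ) → ℝ} (hf : MemCm d 2 f) (i k : Fin d) :
    Set.EqOn (pd d k (pd d i f)) (pd d i (pd d k f)) (cube d) := by
  rcases eq_or_ne i k with rfl | hik
  · exact fun _ _ => rfl
  intro x hx
  have hc : Continuous fun q : ℝ × ℝ => Function.update (Function.update x i q.1) k q.2 :=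
    ((continuous_const (y := x)).update i continuous_fst).update k continuous_snd
  have hmaps : Set.MapsTo (fun q : ℝ × ℝ => Function.update (Function.update x i q.1) k q.2)
      (Set.Icc (0:ℝ) 1 ×ˢ Set.Icc (0:ℝ) 1) (cube d) :=
    fun q hq => update_mem_cube (update_mem_cube hx i hq.1) k hq.2
  have hcomm : ∀ s t : ℝ, Function.update (Function.update x i s) k t =
      Function.update (Function.update x k t) i s := fun s t =>
    Function.update_comm hik s t x
  have := mixed_deriv_comm
    (u := fun s t => f (Function.update (Function.update x i s) k t))
    (v := fun s t => pd d i f (Function.update (Function.update x i s) k t))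
    (v' := fun s t => pd d k f (Function.update (Function.update x i s) k t))
    (w := fun s t => pd d k (pd d i f) (Function.update (Function.update x i s) k t))
    (w' := fun s t => pd d i (pd d k f) (Function.update (Function.update x i s) k t))
    (fun s hs t ht => by
      simpa only [hcomm] using hf.hasDerivWithinAt i (update_mem_cube hx k ht) hs)
    (fun s hs t ht => (hf.2 i).2.hasDerivWithinAt k (update_mem_cube hx i hs) ht)
    (fun s hs t ht => hf.hasDerivWithinAt k (update_mem_cube hx i hs) ht)
    (fun s hs t ht => by
      simpa only [hcomm] using (hf.2 k).2.hasDerivWithinAt i (update_mem_cube hx k ht) hs)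
    (((hf.2 i).2.2 k).2.continuousOn.comp hc.continuousOn hmaps)
    (((hf.2 k).2.2 i).2.continuousOn.comp hc.continuousOn hmaps)
    (hx i trivial) (hx k trivial)
  simpa using this

lemma pd_iterate_comm_eqOn {d n : ℕ} {f : (Fin d → ℝ) → ℝ} (hf : MemCm d (n + 1) f)
    (i k : Fin d) :
    Set.EqOn ((pd d k)^[n] (pd d i f)) (pd d i ((pd d k)^[n] f)) (cube d) := by
  induction n generalizing f with
  | zero => exact fun _ _ => rfl
  | succ n ih =>
    exact (pd_iterate_eqOn_cube (pd_comm_eqOn (hf.mono (by omega)) i k) k n).trans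
      (ih (hf.2 k).2)

lemma isCompact_cube (d : ℕ) : IsCompact (cube d) :=
  isCompact_univ_pi fun _ => isCompact_Icc

lemma eventually_abs_sub_update_le {d : ℕ} {F : (Fin d → ℝ) → ℝ} (hF : ContinuousOn F (cube d))
    (k : Fin d) {x : Fin d → ℝ} (hx : x ∈ cube d) {ε : ℝ} (hε : 0 < ε) :
    ∀ᶠ x' in nhdsWithin x (cube d), ∀ s ∈ Set.Icc (0:ℝ) 1,
      |F (Function.update x' k s) - F (Function.update x k s)| ≤ ε := by
  obtain ⟨δ, hδ, h⟩ := Metric.uniformContinuousOn_iff.1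
    ((isCompact_cube d).uniformContinuousOn_of_continuous hF) ε hε
  filter_upwards [self_mem_nhdsWithin, mem_nhdsWithin_of_mem_nhds (Metric.ball_mem_nhds x hδ)]
    with x' hx' hd s hs
  refine (h _ (update_mem_cube hx' k hs) _ (update_mem_cube hx k hs) ?_).le
  refine lt_of_le_of_lt ((dist_pi_le_iff dist_nonneg).2 fun j => ?_) (Metric.mem_ball.1 hd)
  rcases eq_or_ne j k with rfl | hj
  · simp
  · simpa [hj] using dist_le_pi_dist x' x j

lemma exists_abs_slope_error_le {d : ℕ} {F : (Fin d → ℝ) → ℝ} (hF : MemCm d 1 F)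
    (i : Fin d) {ε : ℝ} (hε : 0 < ε) :
    ∃ δ > 0, ∀ x ∈ cube d, ∀ t ∈ Set.Icc (0:ℝ) 1, |t - x i| < δ →
      |F (Function.update x i t) - F x - (t - x i) * pd d i F x| ≤ ε * |t - x i| := by
  obtain ⟨δ, hδ, h⟩ := Metric.uniformContinuousOn_iff.1
    ((isCompact_cube d).uniformContinuousOn_of_continuous (hF.2 i).2.continuousOn) ε hε
  refine ⟨δ, hδ, fun x hx t ht htd => ?_⟩
  have hxi : x i ∈ Set.Icc (0:ℝ) 1 := hx i trivial
  have hsub : Set.uIcc (x i) t ⊆ Set.Icc (0:ℝ) 1 := Set.uIcc_subset_Icc hxi ht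
  have key := (convex_uIcc (x i) t).norm_image_sub_le_of_norm_hasDerivWithin_le
    (f := fun r => F (Function.update x i r) - r * pd d i F x)
    (f' := fun r => pd d i F (Function.update x i r) - 1 * pd d i F x) (C := ε)
    (fun r hr => ((hF.hasDerivWithinAt i hx (hsub hr)).mono hsub).sub
      ((hasDerivWithinAt_id r _).mul_const _))
    (fun r hr => by
      rw [one_mul, ← dist_eq_norm]
      refine (h _ (update_mem_cube hx i (hsub hr)) _ hx ?_).le
      refine lt_of_le_of_lt ((dist_pi_le_iff (abs_nonneg (t - x i))).2 fun j => ?_) htd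
      rcases eq_or_ne j i with rfl | hj
      · simpa [Real.dist_eq] using Set.abs_sub_left_of_mem_uIcc hr
      · simp [hj])
    Set.left_mem_uIcc Set.right_mem_uIcc
  simp only [Function.update_eq_self, Real.norm_eq_abs] at key
  refine le_trans (le_of_eq ?_) key
  congr 1
  ring

/-- An operator on functions on `[0,1]` that is linear and maps `C^m([0,1])` boundedly into
itself for every `m ≤ N`. -/
structure IsBoundedC1dOp (N : ℕ) (c : ℝ) (T : (ℝ → ℝ) → ℝ → ℝ) : Prop where
  memC1d : ∀ m ≤ N, ∀ φ, MemC1d m φ → MemC1d m (T φ)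
  map_add_const_mul : ∀ φ ψ, ContinuousOn φ (Set.Icc (0:ℝ) 1) →
    ContinuousOn ψ (Set.Icc (0:ℝ) 1) → ∀ r : ℝ,
    Set.EqOn (T fun z => φ z + r * ψ z) (fun z => T φ z + r * T ψ z) (Set.Icc (0:ℝ) 1)
  norm_le : ∀ m ≤ N, ∀ φ, MemC1d m φ → C1dNorm m (T φ) ≤ c * C1dNorm m φ

lemma MemC1d.continuousOn_dI_iterate {m n : ℕ} {φ : ℝ → ℝ} (hφ : MemC1d m φ) (hn : n ≤ m) :
    ContinuousOn (dI^[n] φ) (Set.Icc (0:ℝ) 1) := by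
  obtain ⟨k, rfl⟩ := Nat.exists_eq_add_of_le hn
  exact hφ.dI_iterate.continuousOn

lemma MemC1d.abs_dI_iterate_le_C1dNorm {m n : ℕ} {φ : ℝ → ℝ} (hφ : MemC1d m φ) (hn : n ≤ m)
    {z : ℝ} (hz : z ∈ Set.Icc (0:ℝ) 1) : |dI^[n] φ z| ≤ C1dNorm m φ := by
  have hbdd : BddAbove (Set.range fun z : Set.Icc (0:ℝ) 1 => |dI^[n] φ z.1|) := by
    have := (isCompact_Icc.bddAbove_image (hφ.continuousOn_dI_iterate hn).abs)
    rwa [Set.image_eq_range] at this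
  refine (le_ciSup hbdd ⟨z, hz⟩).trans ?_
  exact le_ciSup (f := fun k : Fin (m + 1) => ⨆ z : Set.Icc (0:ℝ) 1, |dI^[(k : ℕ)] φ z.1|)
    (Set.finite_range _).bddAbove ⟨n, Nat.lt_succ_of_le hn⟩

lemma C1dNorm_le {m : ℕ} {φ : ℝ → ℝ} {ε : ℝ}
    (h : ∀ n ≤ m, ∀ z ∈ Set.Icc (0:ℝ) 1, |dI^[n] φ z| ≤ ε) : C1dNorm m φ ≤ ε := by
  have : Nonempty (Set.Icc (0:ℝ) 1) := ⟨⟨0, by simp⟩⟩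
  exact ciSup_le fun k => ciSup_le fun z => h k (Nat.le_of_lt_succ k.2) z z.2

namespace IsBoundedC1dOp

variable {N : ℕ} {c : ℝ} {T : (ℝ → ℝ) → ℝ → ℝ}

lemma abs_dI_iterate_le (hT : IsBoundedC1dOp N c T) (hc : 0 ≤ c) {a : ℕ} (ha : a ≤ N)
    {φ : ℝ → ℝ} (hφ : MemC1d a φ) {ε : ℝ}
    (h : ∀ n ≤ a, ∀ z ∈ Set.Icc (0:ℝ) 1, |dI^[n] φ z| ≤ ε) {z : ℝ}
    (hz : z ∈ Set.Icc (0:ℝ) 1) : |dI^[a] (T φ) z| ≤ c * ε :=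
  ((hT.memC1d a ha φ hφ).abs_dI_iterate_le_C1dNorm le_rfl hz).trans
    ((hT.norm_le a ha φ hφ).trans (mul_le_mul_of_nonneg_left (C1dNorm_le h) hc))

lemma dI_iterate_map_add_const_mul (hT : IsBoundedC1dOp N c T) {a : ℕ} (ha : a ≤ N)
    {φ ψ : ℝ → ℝ} (hφ : MemC1d a φ) (hψ : MemC1d a ψ) (r : ℝ) :
    Set.EqOn (dI^[a] (T fun z => φ z + r * ψ z))
      (fun z => dI^[a] (T φ) z + r * dI^[a] (T ψ) z) (Set.Icc (0:ℝ) 1) :=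
  (dI_iterate_eqOn (hT.map_add_const_mul φ ψ hφ.continuousOn hψ.continuousOn r) a).trans
    (dI_iterate_add_const_mul_eqOn (hT.memC1d a ha φ hφ) (hT.memC1d a ha ψ hψ) r)

end IsBoundedC1dOp

/-- The `a`-th partial derivative in the coordinate `k` of the function obtained by letting the
operator `T` act on the coordinate `k`. -/
def coordOp (d : ℕ) (T : (ℝ → ℝ) → ℝ → ℝ) (k : Fin d) (a : ℕ) (f : (Fin d → ℝ) → ℝ) :
    (Fin d → ℝ) → ℝ :=
  fun x => dI^[a] (T fun s => f (Function.update x k s)) (x k)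

lemma coordOp_update {d : ℕ} (T : (ℝ → ℝ) → ℝ → ℝ) (k : Fin d) (a : ℕ)
    (f : (Fin d → ℝ) → ℝ) (x : Fin d → ℝ) (t : ℝ) :
    coordOp d T k a f (Function.update x k t) =
      dI^[a] (T fun s => f (Function.update x k s)) t := by
  simp [coordOp]

lemma pd_coordOp_self {d : ℕ} (T : (ℝ → ℝ) → ℝ → ℝ) (k : Fin d) (a : ℕ)
    (f : (Fin d → ℝ) → ℝ) : pd d k (coordOp d T k a f) = coordOp d T k (a + 1) f := by
  funext x
  simp only [pd, coordOp_update]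
  rw [coordOp, Function.iterate_succ_apply']
  rfl

lemma dI_iterate_add_const_mul_update {d a n : ℕ} {f g : (Fin d → ℝ) → ℝ} (hn : n ≤ a)
    (hf : MemCm d a f) (hg : MemCm d a g) {x y : Fin d → ℝ} (hx : x ∈ cube d) (hy : y ∈ cube d)
    (k : Fin d) (r : ℝ) {s : ℝ} (hs : s ∈ Set.Icc (0:ℝ) 1) :
    dI^[n] (fun s => f (Function.update x k s) + r * g (Function.update y k s)) s =
      (pd d k)^[n] f (Function.update x k s) + r * (pd d k)^[n] g (Function.update y k s) := by
  rw [dI_iterate_add_const_mul_eqOn ((hf.mono hn).memC1d_update hx k)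
    ((hg.mono hn).memC1d_update hy k) r hs, dI_iterate_update, dI_iterate_update]

lemma continuousOn_coordOp {d N a : ℕ} {c : ℝ} {T : (ℝ → ℝ) → ℝ → ℝ}
    (hT : IsBoundedC1dOp N c T) (hc : 0 < c) (ha : a ≤ N) (k : Fin d) {f : (Fin d → ℝ) → ℝ}
    (hf : MemCm d a f) : ContinuousOn (coordOp d T k a f) (cube d) := by
  intro x hx
  rw [ContinuousWithinAt, Metric.tendsto_nhds]
  intro ε hε
  have hε' : 0 < ε / (4 * c) := by positivity
  have h₁ : ∀ᶠ x' in nhdsWithin x (cube d), ∀ n ∈ Finset.range (a + 1),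
      ∀ s ∈ Set.Icc (0:ℝ) 1, |(pd d k)^[n] f (Function.update x' k s) -
        (pd d k)^[n] f (Function.update x k s)| ≤ ε / (4 * c) := by
    rw [Filter.eventually_all_finset]
    intro n hn
    obtain ⟨m, hm⟩ := Nat.exists_eq_add_of_le (Finset.mem_range_succ_iff.1 hn)
    exact eventually_abs_sub_update_le ((hm ▸ hf).pd_iterate k).continuousOn k hx hε'
  have hφ := hf.memC1d_update hx k
  have h₂ : ∀ᶠ x' in nhdsWithin x (cube d),
      |dI^[a] (T fun s => f (Function.update x k s)) (x' k) - coordOp d T k a f x| < ε / 2 := by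
    have hcont := (hT.memC1d a ha _ hφ).continuousOn_dI_iterate le_rfl (x k) (hx k trivial)
    have htend : Tendsto (fun x' : Fin d → ℝ => x' k) (nhdsWithin x (cube d))
        (nhdsWithin (x k) (Set.Icc (0:ℝ) 1)) :=
      (continuous_apply k).continuousWithinAt.tendsto_nhdsWithin fun y hy => hy k trivial
    exact Metric.tendsto_nhds.1 (hcont.tendsto.comp htend) (ε / 2) (by positivity)
  filter_upwards [h₁, h₂, self_mem_nhdsWithin] with x' h₁ h₂ hx'
  have hφ' := hf.memC1d_update hx' k
  have hz : x' k ∈ Set.Icc (0:ℝ) 1 := hx' k trivial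
  have h₃ := hT.abs_dI_iterate_le hc.le ha (hφ'.add_const_mul hφ (-1)) (ε := ε / (4 * c))
    (fun n hn s hs => by
      rw [dI_iterate_add_const_mul_update hn hf hf hx' hx k (-1) hs, neg_one_mul, ← sub_eq_add_neg]
      exact h₁ n (Finset.mem_range_succ_iff.2 hn) s hs) hz
  rw [hT.dI_iterate_map_add_const_mul ha hφ' hφ (-1) hz] at h₃
  have h₄ : c * (ε / (4 * c)) = ε / 4 := by field_simp
  rw [h₄] at h₃
  rw [Real.dist_eq]
  rw [coordOp] at h₂ ⊢
  rw [abs_lt] at h₂ ⊢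
  rw [abs_le] at h₃
  constructor <;> simp only [coordOp] at * <;> linarith [h₂.1, h₂.2, h₃.1, h₃.2]

lemma hasDerivWithinAt_coordOp_of_ne {d N a : ℕ} {c : ℝ} {T : (ℝ → ℝ) → ℝ → ℝ}
    (hT : IsBoundedC1dOp N c T) (hc : 0 < c) (ha : a ≤ N) {i k : Fin d} (hik : i ≠ k)
    {f : (Fin d → ℝ) → ℝ} (hf : MemCm d (a + 1) f) {x : Fin d → ℝ} (hx : x ∈ cube d) :
    HasDerivWithinAt (fun t => coordOp d T k a f (Function.update x i t))
      (coordOp d T k a (pd d i f) x) (Set.Icc (0:ℝ) 1) (x i) := by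
  rw [hasDerivWithinAt_iff_isLittleO, Asymptotics.isLittleO_iff]
  intro ε hε
  have h₁ : ∀ᶠ t in nhdsWithin (x i) (Set.Icc (0:ℝ) 1), ∀ n ∈ Finset.range (a + 1),
      ∀ s ∈ Set.Icc (0:ℝ) 1,
        |(pd d k)^[n] f (Function.update (Function.update x i t) k s) -
          (pd d k)^[n] f (Function.update x k s) -
          (t - x i) * (pd d k)^[n] (pd d i f) (Function.update x k s)| ≤
            ε / c * |t - x i| := by
    rw [Filter.eventually_all_finset]
    intro n hn
    have hn := Finset.mem_range_succ_iff.1 hn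
    obtain ⟨δ, hδ, h⟩ := exists_abs_slope_error_le
      ((hf.mono (Nat.add_le_add_right hn 1)).pd_iterate k) i (div_pos hε hc)
    filter_upwards [self_mem_nhdsWithin, mem_nhdsWithin_of_mem_nhds (Metric.ball_mem_nhds _ hδ)]
      with t ht htd s hs
    have hmem := update_mem_cube hx k hs
    have := h _ hmem t ht (by simpa [hik, Real.dist_eq] using htd)
    rw [Function.update_of_ne hik, Function.update_comm hik.symm] at this
    rwa [pd_iterate_comm_eqOn (hf.mono (Nat.add_le_add_right hn 1)) i k hmem]
  filter_upwards [h₁, self_mem_nhdsWithin] with t h₁ ht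
  have hx' := update_mem_cube hx i ht
  have hz : x k ∈ Set.Icc (0:ℝ) 1 := hx k trivial
  have hφ := hf.of_succ.memC1d_update hx k
  have hφ' := hf.of_succ.memC1d_update hx' k
  have hψ := (hf.2 i).2.memC1d_update hx k
  have hd := hφ'.add_const_mul hφ (-1)
  have h₃ := hT.abs_dI_iterate_le hc.le ha (hd.add_const_mul hψ (-(t - x i)))
    (ε := ε / c * |t - x i|)
    (fun n hn s hs => by
      rw [dI_iterate_add_const_mul_eqOn (((hf.of_succ.mono hn).memC1d_update hx' k).add_const_mul
          ((hf.of_succ.mono hn).memC1d_update hx k) (-1))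
        (((hf.2 i).2.mono hn).memC1d_update hx k) _ hs]
      beta_reduce
      rw [dI_iterate_add_const_mul_update hn hf.of_succ hf.of_succ hx' hx k (-1) hs, dI_iterate_update]
      refine le_trans (le_of_eq ?_) (h₁ n (Finset.mem_range_succ_iff.2 hn) s hs)
      congr 1
      ring) hz
  rw [hT.dI_iterate_map_add_const_mul ha hd hψ _ hz] at h₃
  beta_reduce at h₃
  rw [hT.dI_iterate_map_add_const_mul ha hφ' hφ (-1) hz] at h₃
  have h₄ : c * (ε / c * |t - x i|) = ε * |t - x i| := by field_simp
  rw [h₄] at h₃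
  rw [Real.norm_eq_abs, Real.norm_eq_abs]
  refine le_trans (le_of_eq ?_) h₃
  congr 1
  simp only [coordOp, Function.update_of_ne hik.symm, Function.update_eq_self, smul_eq_mul]
  ring

lemma memCm_coordOp {d N a m : ℕ} {c : ℝ} {T : (ℝ → ℝ) → ℝ → ℝ}
    (hT : IsBoundedC1dOp N c T) (hc : 0 < c) (k : Fin d) (ham : a + m ≤ N)
    {f : (Fin d → ℝ) → ℝ} (hf : MemCm d (a + m) f) : MemCm d m (coordOp d T k a f) := by
  induction m generalizing a f with
  | zero => exact continuousOn_coordOp hT hc ham k hf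
  | succ m ih =>
    refine ⟨continuousOn_coordOp hT hc (by omega) k (hf.mono (by omega)), fun i => ?_⟩
    rcases eq_or_ne i k with rfl | hik
    · rw [pd_coordOp_self]
      refine ⟨fun x hx => ?_, ih (by omega) (by rwa [Nat.add_right_comm])⟩
      simp only [coordOp_update]
      have := hT.memC1d (a + (m + 1)) ham _ (hf.memC1d_update hx i)
      exact this.dI_iterate.2.1 _ (hx i trivial)
    · have hd : ∀ x ∈ cube d, _ := fun x hx =>
        hasDerivWithinAt_coordOp_of_ne (a := a) hT hc (by omega) hik (hf.mono (by omega)) hx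
      refine ⟨fun x hx => (hd x hx).differentiableWithinAt, ?_⟩
      refine (ih (a := a) (by omega) (hf.2 i).2).congr fun x hx => ?_
      exact ((hd x hx).derivWithin (uniqueDiffOn_Icc one_pos _ (hx i trivial))).symm

lemma integrable_of_continuousOn_Icc {μ : Measure ℝ} [IsFiniteMeasure μ]
    (hμ : μ (Set.Icc (0:ℝ) 1)ᶜ = 0) {φ : ℝ → ℝ} (hφ : ContinuousOn φ (Set.Icc (0:ℝ) 1)) :
    Integrable φ μ := by
  have h : IntegrableOn φ (Set.Icc (0:ℝ) 1) μ := hφ.integrableOn_compact isCompact_Icc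
  have hae : ∀ᵐ y ∂μ, y ∈ Set.Icc (0:ℝ) 1 := mem_ae_iff.2 hμ
  rwa [IntegrableOn, Measure.restrict_eq_self_of_ae_mem hae] at h

lemma isBoundedC1dOp_integral {N : ℕ} {c : ℝ} {p : ℝ → Measure ℝ}
    [∀ z, IsProbabilityMeasure (p z)] (hsupp : ∀ z, p z (Set.Icc (0:ℝ) 1)ᶜ = 0)
    (hp : ∀ m ≤ N, ∀ φ : ℝ → ℝ, MemC1d m φ → MemC1d m (fun z => ∫ y, φ y ∂ p z) ∧
      C1dNorm m (fun z => ∫ y, φ y ∂ p z) ≤ c * C1dNorm m φ) :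
    IsBoundedC1dOp N c fun φ z => ∫ y, φ y ∂ p z where
  memC1d m hm φ hφ := (hp m hm φ hφ).1
  map_add_const_mul φ ψ hφ hψ r z _ := by
    simp only
    rw [integral_add (integrable_of_continuousOn_Icc (hsupp z) hφ)
      ((integrable_of_continuousOn_Icc (hsupp z) hψ).const_mul r), integral_const_mul]
  norm_le m hm φ hφ := (hp m hm φ hφ).2

lemma map_update_pi_prod {ι : Type*} [Fintype ι] [DecidableEq ι] {α : ι → Type*}
    [∀ i, MeasurableSpace (α i)] (μ μ' : ∀ i, Measure (α i)) [∀ i, IsProbabilityMeasure (μ i)]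
    [∀ i, IsProbabilityMeasure (μ' i)] (k : ι) (h : ∀ i ≠ k, μ' i = μ i) :
    ((Measure.pi μ).prod (μ' k)).map (fun q => Function.update q.1 k q.2) = Measure.pi μ' := by
  symm
  refine Measure.pi_eq fun s hs => ?_
  have hm : Measurable fun q : (∀ i, α i) × α k => Function.update q.1 k q.2 :=
    measurable_update'
  have hpre : (fun q : (∀ i, α i) × α k => Function.update q.1 k q.2) ⁻¹' Set.univ.pi s =
      Set.univ.pi (Function.update s k Set.univ) ×ˢ s k := by
    ext q
    simp only [Set.mem_preimage, Set.mem_univ_pi, Set.mem_prod]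
    constructor
    · intro hq
      refine ⟨fun i => ?_, by simpa using hq k⟩
      rcases eq_or_ne i k with rfl | hi
      · simp
      · simpa [hi] using hq i
    · rintro ⟨hq, hk⟩ i
      rcases eq_or_ne i k with rfl | hi
      · simpa using hk
      · simpa [hi] using hq i
  rw [Measure.map_apply hm (MeasurableSet.univ_pi hs), hpre, Measure.prod_prod, Measure.pi_pi,
    ← Finset.mul_prod_erase Finset.univ _ (Finset.mem_univ k),
    ← Finset.mul_prod_erase Finset.univ (fun i => μ' i (s i)) (Finset.mem_univ k),
    Function.update_self, measure_univ, one_mul, mul_comm]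
  congr 1
  refine Finset.prod_congr rfl fun i hi => ?_
  have hi := Finset.ne_of_mem_erase hi
  rw [Function.update_of_ne hi, h i hi]

/-- The function obtained from `f` by integrating only the coordinates in `S` against the
kernels `p k (x k)`; the measures in the other coordinates play no role. -/
def partialIntegral (d : ℕ) (p : Fin d → ℝ → Measure ℝ) (f : (Fin d → ℝ) → ℝ)
    (S : Finset (Fin d)) : (Fin d → ℝ) → ℝ :=
  fun x => ∫ y, f (S.piecewise y x) ∂Measure.pi fun k => p k (if k ∈ S then x k else 0)

section

variable {d : ℕ} {p : Fin d → ℝ → Measure ℝ} [∀ k z, IsProbabilityMeasure (p k z)]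

lemma partialIntegral_empty (f : (Fin d → ℝ) → ℝ) : partialIntegral d p f ∅ = f := by
  funext x
  simp [partialIntegral]

lemma partialIntegral_insert {f : (Fin d → ℝ) → ℝ} (hf : Continuous f) {C : ℝ}
    (hC : ∀ x, |f x| ≤ C) {S : Finset (Fin d)} {k : Fin d} (hk : k ∉ S) :
    partialIntegral d p f (insert k S) =
      coordOp d (fun φ z => ∫ y, φ y ∂ p k z) k 0 (partialIntegral d p f S) := by
  funext x
  set μ : Fin d → Measure ℝ := fun j => p j (if j ∈ S then x j else 0) with hμ
  set μ' : Fin d → Measure ℝ := fun j => p j (if j ∈ insert k S then x j else 0) with hμ'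
  have : ∀ j, IsProbabilityMeasure (μ j) := fun j => inferInstanceAs (IsProbabilityMeasure (p _ _))
  have : ∀ j, IsProbabilityMeasure (μ' j) := fun j => inferInstanceAs (IsProbabilityMeasure (p _ _))
  have hk' : μ' k = p k (x k) := by simp [hμ']
  have hmap := map_update_pi_prod μ μ' k fun i hi => by simp [hμ, hμ', hi]
  have hpc : Continuous fun y : Fin d → ℝ => (insert k S).piecewise y x := by
    refine continuous_pi fun j => ?_
    by_cases hj : j ∈ insert k S
    · simpa only [Finset.piecewise_eq_of_mem _ _ _ hj] using continuous_apply j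
    · simpa only [Finset.piecewise_eq_of_notMem _ _ _ hj] using continuous_const
  have huc : Continuous fun q : (Fin d → ℝ) × ℝ => Function.update q.1 k q.2 :=
    continuous_fst.update k continuous_snd
  have hupd : ∀ (y : Fin d → ℝ) (s : ℝ), (insert k S).piecewise (Function.update y k s) x =
      S.piecewise y (Function.update x k s) := by
    intro y s
    funext j
    rcases eq_or_ne j k with rfl | hj
    · simp [hk]
    · by_cases hS : j ∈ S <;> simp [hj, hS]
  have hint : Integrable (fun q : (Fin d → ℝ) × ℝ =>
      f ((insert k S).piecewise (Function.update q.1 k q.2) x))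
      ((Measure.pi μ).prod (μ' k)) :=
    Integrable.of_bound (hf.comp (hpc.comp huc)).aestronglyMeasurable C
      (Eventually.of_forall fun q => hC _)
  calc partialIntegral d p f (insert k S) x
      = ∫ y, f ((insert k S).piecewise y x) ∂((Measure.pi μ).prod (μ' k)).map
          (fun q => Function.update q.1 k q.2) := by rw [hmap]; rfl
    _ = ∫ q, f ((insert k S).piecewise (Function.update q.1 k q.2) x)
          ∂(Measure.pi μ).prod (μ' k) :=
        integral_map huc.aemeasurable (hf.comp hpc).aestronglyMeasurable
    _ = ∫ s, ∫ y, f ((insert k S).piecewise (Function.update y k s) x) ∂Measure.pi μ ∂μ' k :=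
        integral_prod_symm _ hint
    _ = coordOp d (fun φ z => ∫ y, φ y ∂ p k z) k 0 (partialIntegral d p f S) x := by
        rw [hk']
        refine integral_congr_ae (Eventually.of_forall fun s => ?_)
        simp only [hupd, partialIntegral]
        congr 2
        funext j
        rcases eq_or_ne j k with rfl | hj
        · simp [hμ, hk]
        · simp [hμ, hj]

lemma memCm_partialIntegral {N : ℕ} {c : ℝ} (hc : 0 < c)
    (hp : ∀ k, IsBoundedC1dOp N c fun φ z => ∫ y, φ y ∂ p k z) {f : (Fin d → ℝ) → ℝ}
    (hf : MemCm d N f) (hfc : Continuous f) {C : ℝ} (hC : ∀ x, |f x| ≤ C)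
    (S : Finset (Fin d)) : MemCm d N (partialIntegral d p f S) := by
  induction S using Finset.induction_on with
  | empty => rwa [partialIntegral_empty]
  | insert k S hk ih =>
    rw [partialIntegral_insert hfc hC hk]
    exact memCm_coordOp (hp k) hc k (Nat.zero_add N).le (by rwa [Nat.zero_add])

lemma ae_pi_mem_cube (hsupp : ∀ k z, p k z (Set.Icc (0:ℝ) 1)ᶜ = 0) (x : Fin d → ℝ) :
    ∀ᵐ y ∂Measure.pi (fun k => p k (x k)), y ∈ cube d := by
  have h : ∀ᵐ y ∂Measure.pi (fun k => p k (x k)), ∀ k, y k ∈ Set.Icc (0:ℝ) 1 :=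
    eventually_all.2 fun k =>
      (Measure.quasiMeasurePreserving_eval (fun k => p k (x k)) k).ae (mem_ae_iff.2 (hsupp k (x k)))
  filter_upwards [h] with y hy k _ using hy k

end

lemma exists_continuous_bounded_eqOn_cube {d : ℕ} {f : (Fin d → ℝ) → ℝ}
    (hf : ContinuousOn f (cube d)) :
    ∃ g : (Fin d → ℝ) → ℝ, Continuous g ∧ (∃ C, ∀ x, |g x| ≤ C) ∧ Set.EqOn f g (cube d) := by
  set r : (Fin d → ℝ) → Fin d → ℝ :=
    fun x k => (Set.projIcc (0:ℝ) 1 zero_le_one (x k) : ℝ) with hr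
  have hrc : Continuous r := continuous_pi fun k =>
    continuous_subtype_val.comp (continuous_projIcc.comp (continuous_apply k))
  have hmem : ∀ x, r x ∈ cube d := fun x k _ => (Set.projIcc (0:ℝ) 1 zero_le_one (x k)).2
  obtain ⟨C, hC⟩ := (isCompact_cube d).exists_bound_of_continuousOn hf
  refine ⟨f ∘ r, hf.comp_continuous hrc hmem, ⟨C, fun x => hC _ (hmem x)⟩, fun x hx => ?_⟩
  have : r x = x := by
    funext k
    simp [hr, Set.projIcc_of_mem zero_le_one (hx k trivial)]
  simp [this]

lemma memCm_integral_pi {d N : ℕ} {p : Fin d → ℝ → Measure ℝ}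
    [∀ k z, IsProbabilityMeasure (p k z)] (hsupp : ∀ k z, p k z (Set.Icc (0:ℝ) 1)ᶜ = 0)
    {c : ℝ} (hc : 0 < c) (hp : ∀ k, IsBoundedC1dOp N c fun φ z => ∫ y, φ y ∂ p k z)
    {f : (Fin d → ℝ) → ℝ} (hf : MemCm d N f) :
    MemCm d N fun x => ∫ y, f y ∂Measure.pi fun k => p k (x k) := by
  obtain ⟨g, hg, ⟨C, hC⟩, hfg⟩ := exists_continuous_bounded_eqOn_cube hf.continuousOn
  refine (memCm_partialIntegral hc hp (hf.congr hfg) hg hC Finset.univ).congr fun x _ => ?_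
  simp only [partialIntegral, Finset.piecewise_univ, Finset.mem_univ, if_true]
  refine integral_congr_ae ?_
  filter_upwards [ae_pi_mem_cube hsupp x] with y hy using (hfg hy).symm

lemma MemCm.pec {d : ℕ} {L : List (Fin d)} {f : (Fin d → ℝ) → ℝ} (hf : MemCm d L.length f) :
    PEC d L f := by
  induction L generalizing f with
  | nil => exact hf
  | cons i L ih => exact ⟨(hf.2 i).1, ih (hf.2 i).2⟩

/-- Continuity of mixed third derivatives: if each kernel `p^k` maps `C^{m'}([0,1],ℝ)`
into itself with operator norm at most `c` for `m' ∈ {0,1,2,3}`, then for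
`f ∈ C³([0,1]^d,ℝ)` and every `i, j, l` the mixed third partial derivative
`∂³/(∂x_i ∂x_j ∂x_l)` of `x ↦ ∫ f(y) ⊗_{k=1}^d p^k(x_k,dy_k)` exists and is continuous
on `[0,1]^d`. -/
theorem continuity_mixed_third_derivatives_product_kernel
    (d : ℕ) (hd : 0 < d) (c : ℝ) (hc : 1 ≤ c)
    (p : Fin d → ℝ → Measure ℝ)
    [∀ k z, IsProbabilityMeasure (p k z)]
    (hmeas : ∀ k : Fin d, Measurable (p k))
    (hsupp : ∀ k : Fin d, ∀ z, p k z (Set.Icc (0:ℝ) 1)ᶜ = 0)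
    (hp : ∀ k : Fin d, ∀ m' ≤ 3, ∀ φ : ℝ → ℝ, MemC1d m' φ →
      MemC1d m' (fun z => ∫ y, φ y ∂ p k z) ∧
      C1dNorm m' (fun z => ∫ y, φ y ∂ p k z) ≤ c * C1dNorm m' φ)
    (f : (Fin d → ℝ) → ℝ) (hf : MemCm d 3 f) (i j l : Fin d) :
    PEC d [l, j, i]
      (fun x : Fin d → ℝ => ∫ y, f y ∂ Measure.pi (fun k => p k (x k))) := by
  exact (memCm_integral_pi hsupp (zero_lt_one.trans_le hc)
    (fun k => isBoundedC1dOp_integral (hsupp k) (hp k)) hf).pec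

end
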